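/- (Triangle recurrence) Let G be a connected simple graph on [N] with an edge e = uv such that deg_G(u) = 2. Then |𝔇(G△e)| = 3·|𝔇(G)|; consequently NVol(∇^PQ_{G△e}) = 3·NVol(∇^PQ_G). -/

import Mathlib

open Finset

attribute [local instance] Classical.propDecidable

/-- The set of neighbors of `i` in `G`, as a `Finset`. -/
noncomputable def nbr {N : ℕ} (G : SimpleGraph (Fin N)) (i : Fin N) : Finset (Fin N) :=
  Finset.univ.filter (fun j => G.Adj i j)

/-- `(a 1, …, a N)` is a `D(G)`-draconian sequence: the entries sum to `N - 1` and for
every nonempty `S ⊆ [N]` one has `∑_{i ∈ S} a i < |S ∪ ⋃_{i ∈ S} N_G(i)|`. -/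
def draconian {N : ℕ} (G : SimpleGraph (Fin N)) (a : Fin N → ℕ) : Prop :=
  (∑ i, a i) = N - 1 ∧
  ∀ S : Finset (Fin N), S.Nonempty →
    (∑ i ∈ S, a i) < (S ∪ S.biUnion (fun i => nbr G i)).card

/-- The subdivision `G : e` of the edge `e = uv` of `G`: the graph on `[N+1]` with edge
set `(E(G) ∖ {uv}) ∪ {u(N+1), v(N+1)}`. -/
def subdiv {N : ℕ} (G : SimpleGraph (Fin N)) (u v : Fin N) : SimpleGraph (Fin (N + 1)) :=
  SimpleGraph.fromRel (fun i j =>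
    (∃ a b : Fin N, i = a.castSucc ∧ j = b.castSucc ∧ G.Adj a b ∧
      ¬(a = u ∧ b = v) ∧ ¬(a = v ∧ b = u))
    ∨ (i = u.castSucc ∧ j = Fin.last N) ∨ (i = v.castSucc ∧ j = Fin.last N))

/-- The graph `G △ e` for an edge `e = uv` of `G`: the graph on `[N+1]` with edge set
`E(G) ∪ {u(N+1), v(N+1)}`. -/
def triExt {N : ℕ} (G : SimpleGraph (Fin N)) (u v : Fin N) : SimpleGraph (Fin (N + 1)) :=
  SimpleGraph.fromRel (fun i j =>
    (∃ a b : Fin N, i = a.castSucc ∧ j = b.castSucc ∧ G.Adj a b)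
    ∨ (i = u.castSucc ∧ j = Fin.last N) ∨ (i = v.castSucc ∧ j = Fin.last N))

/-- A graph on `[N]` is `2`-connected if it has at least `3` vertices, is connected, and
remains connected after deleting any single vertex. -/
def TwoConnected {N : ℕ} (G : SimpleGraph (Fin N)) : Prop :=
  3 ≤ N ∧ G.Connected ∧
    ∀ v : Fin N, (G.comap (fun u : {w : Fin N // w ≠ v} => (u : Fin N))).Connected

/-- The closed neighborhood `S ∪ ⋃_{i ∈ S} N_G(i)` of a set `S` of vertices. -/
noncomputable def closedNbr {N : ℕ} (G : SimpleGraph (Fin N)) (S : Finset (Fin N)) :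
    Finset (Fin N) :=
  S ∪ S.biUnion (fun i => nbr G i)

section ClosedNbr

variable {N : ℕ} {G : SimpleGraph (Fin N)} {u v : Fin N}

theorem mem_nbr {i j : Fin N} : j ∈ nbr G i ↔ G.Adj i j := by
  simp [nbr]

theorem mem_closedNbr {S : Finset (Fin N)} {j : Fin N} :
    j ∈ closedNbr G S ↔ j ∈ S ∨ ∃ i ∈ S, G.Adj i j := by
  simp [closedNbr, mem_nbr]

theorem closedNbr_union (S T : Finset (Fin N)) :
    closedNbr G (S ∪ T) = closedNbr G S ∪ closedNbr G T := by
  ext j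
  simp only [mem_closedNbr, mem_union]
  grind

theorem closedNbr_mono {S T : Finset (Fin N)} (h : S ⊆ T) :
    closedNbr G S ⊆ closedNbr G T := by
  intro j
  simp only [mem_closedNbr]
  grind

theorem closedNbr_univ_erase (huv : G.Adj u v) :
    closedNbr G (univ.erase u) = univ := by
  ext j
  simp only [mem_closedNbr, mem_erase, mem_univ, and_true, iff_true]
  by_cases hj : j = u
  · exact Or.inr ⟨v, huv.ne', hj ▸ huv.symm⟩
  · exact Or.inl hj

theorem card_closedNbr_inter_add_card_closedNbr_union_le (S T : Finset (Fin N)) :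
    (closedNbr G (S ∩ T)).card + (closedNbr G (S ∪ T)).card ≤
      (closedNbr G S).card + (closedNbr G T).card := by
  have h : closedNbr G (S ∩ T) ⊆ closedNbr G S ∩ closedNbr G T :=
    subset_inter (closedNbr_mono inter_subset_left) (closedNbr_mono inter_subset_right)
  have := card_le_card h
  have := card_union_add_card_inter (closedNbr G S) (closedNbr G T)
  rw [closedNbr_union]
  omega

theorem draconian_iff {a : Fin N → ℕ} :
    draconian G a ↔ (∑ i, a i) = N - 1 ∧
      ∀ S : Finset (Fin N), S.Nonempty → (∑ i ∈ S, a i) < (closedNbr G S).card :=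
  Iff.rfl

theorem finite_setOf_draconian (G : SimpleGraph (Fin N)) :
    {a : Fin N → ℕ | draconian G a}.Finite := by
  refine (Set.finite_Iic (fun _ : Fin N => N - 1)).subset fun a ha i => ?_
  rw [← ha.1]
  exact single_le_sum (fun _ _ => Nat.zero_le _) (mem_univ i)

theorem sum_add_single (S : Finset (Fin N)) (a : Fin N → ℕ) (u : Fin N) :
    ∑ i ∈ S, (a + Pi.single u 1 : Fin N → ℕ) i = (∑ i ∈ S, a i) + if u ∈ S then 1 else 0 := by
  simp [sum_add_distrib]

end ClosedNbr

section TriExt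

variable {N : ℕ} {G : SimpleGraph (Fin N)} {u v : Fin N}

theorem triExt_adj_castSucc {i j : Fin N} :
    (triExt G u v).Adj i.castSucc j.castSucc ↔ G.Adj i j := by
  simp only [triExt, SimpleGraph.fromRel_adj, ne_eq, Fin.castSucc_inj,
    Fin.castSucc_ne_last, and_false, or_false]
  constructor
  · rintro ⟨-, ⟨a, b, rfl, rfl, h⟩ | ⟨a, b, rfl, rfl, h⟩⟩
    exacts [h, h.symm]
  · exact fun h => ⟨h.ne, Or.inl ⟨i, j, rfl, rfl, h⟩⟩

theorem triExt_adj_last {i : Fin N} :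
    (triExt G u v).Adj i.castSucc (Fin.last N) ↔ i = u ∨ i = v := by
  simp only [triExt, SimpleGraph.fromRel_adj, ne_eq, Fin.castSucc_ne_last, Fin.castSucc_inj,
    (Fin.castSucc_ne_last _).symm, false_and, and_false, exists_false, or_false, false_or,
    and_true, not_false_eq_true, true_and]

theorem card_closedNbr_triExt_map (S : Finset (Fin N)) :
    (closedNbr (triExt G u v) (S.map Fin.castSuccEmb)).card =
      (closedNbr G S).card + if u ∈ S ∨ v ∈ S then 1 else 0 := by
  have hmem (j : Fin N) : j.castSucc ∈ closedNbr (triExt G u v) (S.map Fin.castSuccEmb) ↔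
      j ∈ closedNbr G S := by
    simp [mem_closedNbr, triExt_adj_castSucc]
  have hlast : Fin.last N ∈ closedNbr (triExt G u v) (S.map Fin.castSuccEmb) ↔
      u ∈ S ∨ v ∈ S := by
    simp only [mem_closedNbr, mem_map, Fin.coe_castSuccEmb, Fin.castSucc_ne_last, and_false,
      exists_false, false_or, exists_exists_and_eq_and, triExt_adj_last]
    grind
  split_ifs with h
  · have : closedNbr (triExt G u v) (S.map Fin.castSuccEmb) =
        insert (Fin.last N) ((closedNbr G S).map Fin.castSuccEmb) := by
      ext j
      induction j using Fin.lastCases <;> simp [hmem, hlast, h, Fin.castSucc_ne_last]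
    rw [this, card_insert_of_notMem (by simp [Fin.castSucc_ne_last]), card_map]
  · have : closedNbr (triExt G u v) (S.map Fin.castSuccEmb) =
        (closedNbr G S).map Fin.castSuccEmb := by
      ext j
      induction j using Fin.lastCases <;> simp [hmem, hlast, h, Fin.castSucc_ne_last]
    rw [this, card_map, add_zero]

theorem card_closedNbr_triExt_insert_last (S : Finset (Fin N)) :
    (closedNbr (triExt G u v) (insert (Fin.last N) (S.map Fin.castSuccEmb))).card =
      (closedNbr G S ∪ {u, v}).card + 1 := by
  have : closedNbr (triExt G u v) (insert (Fin.last N) (S.map Fin.castSuccEmb)) =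
      insert (Fin.last N) ((closedNbr G S ∪ {u, v}).map Fin.castSuccEmb) := by
    ext j
    induction j using Fin.lastCases with
    | last => simp [mem_closedNbr]
    | cast j =>
      simp [mem_closedNbr, triExt_adj_castSucc, (triExt G u v).adj_comm (Fin.last N),
        triExt_adj_last, Fin.castSucc_ne_last]
      grind
  rw [this, card_insert_of_notMem
    (by simp [Fin.castSucc_ne_last, (Fin.castSucc_ne_last _).symm]), card_map]

theorem eq_map_or_eq_insert_last (T : Finset (Fin (N + 1))) :
    ∃ S : Finset (Fin N), T = S.map Fin.castSuccEmb ∨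
      T = insert (Fin.last N) (S.map Fin.castSuccEmb) := by
  refine ⟨univ.filter (fun i => i.castSucc ∈ T), ?_⟩
  by_cases h : Fin.last N ∈ T
  · right
    ext j
    induction j using Fin.lastCases <;> simp [h, Fin.castSucc_ne_last]
  · left
    ext j
    induction j using Fin.lastCases <;> simp [h, Fin.castSucc_ne_last]

theorem draconian_triExt_snoc {a : Fin N → ℕ} {c : ℕ} :
    draconian (triExt G u v) (Fin.snoc a c : Fin (N + 1) → ℕ) ↔
      (∑ i, a i) + c = N ∧
      (∀ S : Finset (Fin N), S.Nonempty →
        (∑ i ∈ S, a i) < (closedNbr G S).card + if u ∈ S ∨ v ∈ S then 1 else 0) ∧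
      ∀ S : Finset (Fin N), (∑ i ∈ S, a i) + c < (closedNbr G S ∪ {u, v}).card + 1 := by
  have hmap (S : Finset (Fin N)) :
      ∑ i ∈ S.map Fin.castSuccEmb, (Fin.snoc a c : Fin (N + 1) → ℕ) i = ∑ i ∈ S, a i := by
    simp [sum_map]
  have hins (S : Finset (Fin N)) :
      ∑ i ∈ insert (Fin.last N) (S.map Fin.castSuccEmb), (Fin.snoc a c : Fin (N + 1) → ℕ) i =
        (∑ i ∈ S, a i) + c := by
    rw [sum_insert (by simp [Fin.castSucc_ne_last]), hmap, Fin.snoc_last, add_comm]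
  rw [draconian_iff, Fin.sum_univ_castSucc]
  simp only [Fin.snoc_castSucc, Fin.snoc_last, Nat.add_sub_cancel]
  refine and_congr_right fun _ => ⟨fun h => ⟨fun S hS => ?_, fun S => ?_⟩, fun h T hT => ?_⟩
  · rw [← card_closedNbr_triExt_map, ← hmap]
    exact h _ (hS.map)
  · rw [← card_closedNbr_triExt_insert_last, ← hins]
    exact h _ (insert_nonempty _ _)
  · obtain ⟨S, rfl | rfl⟩ := eq_map_or_eq_insert_last T
    · rw [card_closedNbr_triExt_map, hmap]
      exact h.1 S (by simpa using hT)
    · rw [card_closedNbr_triExt_insert_last, hins]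
      exact h.2 S

theorem draconian_triExt_snoc_one (huv : G.Adj u v) {a : Fin N → ℕ} :
    draconian (triExt G u v) (Fin.snoc a 1 : Fin (N + 1) → ℕ) ↔ draconian G a := by
  have hN : 0 < N := u.pos
  rw [draconian_triExt_snoc, draconian_iff]
  constructor
  · rintro ⟨hsum, h₁, h₂⟩
    refine ⟨by omega, fun S hS => ?_⟩
    by_cases h : u ∈ S ∨ v ∈ S
    · have := h₂ S
      rw [union_eq_left.2] at this
      · omega
      · simp only [insert_subset_iff, singleton_subset_iff, mem_closedNbr]
        have := huv.symm
        grind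
    · simpa [h] using h₁ S hS
  · rintro ⟨hsum, h⟩
    refine ⟨by omega, fun S hS => (h S hS).trans_le (Nat.le_add_right _ _), fun S => ?_⟩
    obtain rfl | hS := S.eq_empty_or_nonempty
    · simp
    · have := h S hS
      have := card_le_card (subset_union_left (s₁ := closedNbr G S) (s₂ := {u, v}))
      omega

/-- If no constraint of `G` obstructs lowering `a` at `u`, the result is draconian; otherwise
there is a tight set containing `v` and avoiding `u`. -/
theorem exists_draconian_add_single_or_exists_tight (huv : G.Adj u v) {a : Fin N → ℕ}
    (hsum : ∑ i, a i = N)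
    (h : ∀ S : Finset (Fin N), S.Nonempty →
      (∑ i ∈ S, a i) < (closedNbr G S).card + if u ∈ S ∨ v ∈ S then 1 else 0) :
    (∃ b, draconian G b ∧ b + Pi.single u 1 = a) ∨
      ∃ S : Finset (Fin N), u ∉ S ∧ v ∈ S ∧ ∑ i ∈ S, a i = (closedNbr G S).card := by
  by_cases ha : a u = 0
  · right
    refine ⟨univ.erase u, by simp, by simp [huv.ne'], ?_⟩
    rw [closedNbr_univ_erase huv, card_univ, Fintype.card_fin, sum_erase _ ha, hsum]
  · obtain ⟨b, rfl⟩ : ∃ b : Fin N → ℕ, b + Pi.single u 1 = a := by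
      refine ⟨a - Pi.single u 1, funext fun i => ?_⟩
      by_cases hi : i = u
      · subst hi
        simp
        omega
      · simp [hi]
    by_cases hb : draconian G b
    · exact Or.inl ⟨b, hb, rfl⟩
    · right
      rw [sum_add_single, if_pos (mem_univ u)] at hsum
      rw [draconian_iff] at hb
      push Not at hb
      obtain ⟨S, hS, hlt⟩ := hb (by omega)
      have hS' := h S hS
      refine ⟨S, ?_⟩
      rw [sum_add_single] at hS' ⊢
      grind

theorem draconian_triExt_snoc_zero (huv : G.Adj u v) {a : Fin N → ℕ} :
    draconian (triExt G u v) (Fin.snoc a 0 : Fin (N + 1) → ℕ) ↔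
      (∃ b, draconian G b ∧ b + Pi.single u 1 = a) ∨
        ∃ b, draconian G b ∧ b + Pi.single v 1 = a := by
  have hN : 0 < N := u.pos
  rw [draconian_triExt_snoc]
  constructor
  · rintro ⟨hsum, h, -⟩
    refine (exists_draconian_add_single_or_exists_tight huv hsum h).imp_right ?_
    rintro ⟨S, huS, hvS, hS⟩
    refine (exists_draconian_add_single_or_exists_tight huv.symm hsum
      (by simpa only [or_comm] using h)).resolve_right ?_
    rintro ⟨T, hvT, huT, hT⟩
    have hsums := sum_union_inter (s₁ := S) (s₂ := T) (f := a)
    have hunion := h (S ∪ T) ⟨u, by simp [huT]⟩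
    rw [if_pos (by simp [huT])] at hunion
    have hcard := card_closedNbr_inter_add_card_closedNbr_union_le (G := G) S T
    obtain hST | hST := (S ∩ T).eq_empty_or_nonempty
    · rw [hST, sum_empty] at hsums
      have hpos : 0 < (closedNbr G S ∩ closedNbr G T).card :=
        card_pos.2 ⟨u, mem_inter.2 ⟨mem_closedNbr.2 (Or.inr ⟨v, hvS, huv.symm⟩),
          mem_closedNbr.2 (Or.inl huT)⟩⟩
      have := card_union_add_card_inter (closedNbr G S) (closedNbr G T)
      rw [closedNbr_union] at hunion
      omega
    · have hinter := h _ hST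
      rw [if_neg (by simp [huS, hvT])] at hinter
      omega
  · intro h
    obtain ⟨w, hw, b, hb, rfl⟩ :
        ∃ w, (w = u ∨ w = v) ∧ ∃ b, draconian G b ∧ b + Pi.single w 1 = a := by
      obtain h | h := h
      exacts [⟨u, Or.inl rfl, h⟩, ⟨v, Or.inr rfl, h⟩]
    rw [draconian_iff] at hb
    have hlt (S : Finset (Fin N)) (hS : S.Nonempty) :
        (∑ i ∈ S, (b + Pi.single w 1 : Fin N → ℕ) i) <
          (closedNbr G S).card + if u ∈ S ∨ v ∈ S then 1 else 0 := by
      have := hb.2 S hS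
      rw [sum_add_single]
      grind
    refine ⟨?_, hlt, fun S => ?_⟩
    · rw [sum_add_single, if_pos (mem_univ w), hb.1]
      omega
    · obtain rfl | hS := S.eq_empty_or_nonempty
      · simp
      · have := hlt S hS
        have := card_le_card (subset_union_left (s₁ := closedNbr G S) (s₂ := {u, v}))
        split_ifs at * <;> omega

theorem draconian_triExt_snoc_two (huv : G.Adj u v) (hdeg : (nbr G u).card = 2)
    {a : Fin N → ℕ} :
    draconian (triExt G u v) (Fin.snoc a 2 : Fin (N + 1) → ℕ) ↔
      draconian G (a + Pi.single u 1) ∧ draconian G (a + Pi.single v 1) := by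
  have hN : 0 < N := u.pos
  rw [draconian_triExt_snoc]
  simp only [draconian_iff, sum_add_single, mem_univ, if_true]
  have hsub (S : Finset (Fin N)) (hS : u ∈ S ∨ v ∈ S) :
      closedNbr G S ∪ {u, v} = closedNbr G S := by
    rw [union_eq_left]
    simp only [insert_subset_iff, singleton_subset_iff, mem_closedNbr]
    have := huv.symm
    grind
  constructor
  · rintro ⟨hsum, h₁, h₂⟩
    have key (w : Fin N) (hw : w = u ∨ w = v) (S : Finset (Fin N)) (hS : S.Nonempty) :
        (∑ i ∈ S, a i) + (if w ∈ S then 1 else 0) < (closedNbr G S).card := by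
      by_cases h : u ∈ S ∨ v ∈ S
      · have := h₂ S
        rw [hsub S h] at this
        split_ifs <;> omega
      · have := h₁ S hS
        grind
    exact ⟨⟨by omega, key u (Or.inl rfl)⟩, ⟨by omega, key v (Or.inr rfl)⟩⟩
  · rintro ⟨⟨hsum, hu⟩, -, hv⟩
    have hlt (S : Finset (Fin N)) (hS : u ∈ S ∨ v ∈ S) :
        (∑ i ∈ S, a i) + 1 < (closedNbr G S).card := by
      obtain h | h := hS
      · simpa [h] using hu S ⟨u, h⟩
      · simpa [h] using hv S ⟨v, h⟩
    refine ⟨by omega, fun S hS => ?_, fun S => ?_⟩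
    · have := hu S hS
      omega
    · by_cases h : u ∈ S ∨ v ∈ S
      · rw [hsub S h]
        have := hlt S h
        omega
      push Not at h
      by_cases huv' : u ∈ closedNbr G S ∧ v ∈ closedNbr G S
      · -- The neighbor of `u` in `S` is not `v`, so `u` adds nothing to the closed neighborhood.
        obtain ⟨w, hwS, hwu⟩ := (mem_closedNbr.1 huv'.1).resolve_left h.1
        have hvw : v ≠ w := fun e => h.2 (e ▸ hwS)
        have hnbr : nbr G u = {v, w} := by
          refine (eq_of_subset_of_card_le ?_ ?_).symm
          · simp [insert_subset_iff, mem_nbr, huv, hwu.symm]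
          · rw [hdeg, card_pair hvw]
        have hins : closedNbr G (insert u S) = closedNbr G S := by
          refine Subset.antisymm (fun j hj => ?_) (closedNbr_mono (subset_insert _ _))
          obtain hj | ⟨i, hi, hij⟩ := mem_closedNbr.1 hj
          · obtain rfl | hj := mem_insert.1 hj
            exacts [huv'.1, mem_closedNbr.2 (Or.inl hj)]
          · obtain rfl | hi := mem_insert.1 hi
            · rw [← mem_nbr, hnbr, mem_insert, mem_singleton] at hij
              obtain rfl | rfl := hij
              exacts [huv'.2, mem_closedNbr.2 (Or.inl hwS)]
            · exact mem_closedNbr.2 (Or.inr ⟨i, hi, hij⟩)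
        have := hlt (insert u S) (Or.inl (mem_insert_self _ _))
        rw [hins, sum_insert h.1] at this
        have := card_le_card (subset_union_left (s₁ := closedNbr G S) (s₂ := {u, v}))
        omega
      · obtain rfl | hS := S.eq_empty_or_nonempty
        · have : closedNbr G ∅ = ∅ := by simp [closedNbr]
          simp [this, card_pair huv.ne]
        · have hss : closedNbr G S ⊂ closedNbr G S ∪ {u, v} := by
            refine Finset.ssubset_iff_subset_ne.2 ⟨subset_union_left, fun e => huv' ?_⟩
            rw [e]
            simp
          have := card_lt_card hss
          have := hu S hS
          omega

theorem last_lt_three_of_draconian_triExt (huv : G.Adj u v) {a : Fin (N + 1) → ℕ}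
    (ha : draconian (triExt G u v) a) : a (Fin.last N) < 3 := by
  rw [← Fin.snoc_init_self a, draconian_triExt_snoc] at ha
  have := ha.2.2 ∅
  have h : closedNbr G ∅ = ∅ := by simp [closedNbr]
  simpa [h, card_pair huv.ne] using this

/-- The `D(G△e)`-draconian sequences are sorted by their last entry, which is `0`, `1` or `2`. -/
theorem ncard_setOf_draconian_triExt (huv : G.Adj u v) :
    {a : Fin (N + 1) → ℕ | draconian (triExt G u v) a}.ncard =
      ∑ c ∈ range 3, {a : Fin N → ℕ |
        draconian (triExt G u v) (Fin.snoc a c : Fin (N + 1) → ℕ)}.ncard := by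
  have hfin := finite_setOf_draconian (triExt G u v)
  rw [Set.ncard_eq_toFinset_card _ hfin, card_eq_sum_card_fiberwise
    (f := fun a : Fin (N + 1) → ℕ => a (Fin.last N)) (t := range 3)]
  · refine sum_congr rfl fun c _ => ?_
    rw [← Set.ncard_coe_finset, ← Set.ncard_image_of_injective {a : Fin N → ℕ | _}
      (Fin.snoc_left_injective (α := fun _ => ℕ) c)]
    refine congrArg Set.ncard (Set.ext fun a => ?_)
    simp only [coe_filter, Set.Finite.mem_toFinset, Set.mem_ofPred_eq, Set.mem_image]
    constructor
    · rintro ⟨ha, rfl⟩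
      exact ⟨Fin.init a, by rwa [Fin.snoc_init_self], Fin.snoc_init_self a⟩
    · rintro ⟨b, hb, rfl⟩
      exact ⟨hb, Fin.snoc_last _ _⟩
  · intro a ha
    simpa using last_lt_three_of_draconian_triExt huv (by simpa using ha)

end TriExt

/-- (Triangle recurrence) Let `G` be connected on `[N]` with an edge `e = uv` such that
`deg_G(u) = 2`. Then `|𝔇(G△e)| = 3·|𝔇(G)|`; consequently
`NVol(∇^PQ_{G△e}) = 3·NVol(∇^PQ_G)`. -/
theorem triangle_recurrence {N : ℕ} (G : SimpleGraph (Fin N)) (hconn : G.Connected)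
    (u v : Fin N) (he : G.Adj u v) (hdeg : (nbr G u).card = 2) :
    {a : Fin (N + 1) → ℕ | draconian (triExt G u v) a}.ncard =
      3 * {a : Fin N → ℕ | draconian G a}.ncard := by
  have hfin := finite_setOf_draconian G
  set B := {a : Fin N → ℕ | draconian G a}
  let shift (w : Fin N) (a : Fin N → ℕ) : Fin N → ℕ := a + Pi.single w 1
  have hinj (w : Fin N) : Function.Injective (shift w) := add_left_injective _
  have h₀ : {a : Fin N → ℕ | draconian (triExt G u v) (Fin.snoc a 0 : Fin (N + 1) → ℕ)} =
      shift u '' B ∪ shift v '' B :=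
    Set.ext fun a => draconian_triExt_snoc_zero he
  have h₁ : {a : Fin N → ℕ | draconian (triExt G u v) (Fin.snoc a 1 : Fin (N + 1) → ℕ)} = B :=
    Set.ext fun a => draconian_triExt_snoc_one he
  have h₂ : (shift v ∘ shift u) '' {a : Fin N → ℕ |
      draconian (triExt G u v) (Fin.snoc a 2 : Fin (N + 1) → ℕ)} =
        shift u '' B ∩ shift v '' B := by
    ext a
    simp only [draconian_triExt_snoc_two he hdeg]
    constructor
    · rintro ⟨m, ⟨hu, hv⟩, rfl⟩
      exact ⟨⟨_, hv, add_right_comm _ _ _⟩, ⟨_, hu, rfl⟩⟩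
    · rintro ⟨⟨b, hb, rfl⟩, ⟨b', hb', h⟩⟩
      obtain ⟨m, rfl⟩ : ∃ m : Fin N → ℕ, m + Pi.single v 1 = b := by
        refine ⟨b - Pi.single v 1, funext fun i => ?_⟩
        by_cases hi : i = v
        · have := congrFun h v
          simp [shift, he.ne'] at this
          subst hi
          simp
          omega
        · simp [hi]
      have hm : b' = m + Pi.single u 1 := hinj v (h.trans (add_right_comm _ _ _))
      exact ⟨m, ⟨hm ▸ hb', hb⟩, add_right_comm _ _ _⟩
  rw [ncard_setOf_draconian_triExt he, sum_range_succ, sum_range_succ, sum_range_one, h₀, h₁,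
    ← Set.ncard_image_of_injective {a : Fin N → ℕ | draconian (triExt G u v) _}
      ((hinj v).comp (hinj u)), h₂]
  have := Set.ncard_union_add_ncard_inter (shift u '' B) (shift v '' B)
    (hfin.image _) (hfin.image _)
  rw [Set.ncard_image_of_injective _ (hinj u), Set.ncard_image_of_injective _ (hinj v)] at this
  omega
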